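/- Let Q ⊂ ℝⁿ (n ≥ 2) be a cube and let p(·) be an exponent function on Q with 1 ≤ p_-(Q) ≤ p_+(Q) < ∞. Fix α ≥ 0 and define q(·) pointwise by 1/q(x) = 1/p(x) − α/n, assuming q(x) ≥ 1. Suppose either (i) p_-(Q) < n and p_-(Q) ≤ q_+(Q) ≤ (p_-(Q))* = n p_-(Q)/(n − p_-(Q)), or (ii) p_-(Q) ≥ n and q_+(Q) < ∞. Then for every locally Lipschitz f ∈ L¹(Q), ‖f − f_Q‖_{L^{q(·)}(Q)} ≤ C(n, q_+(Q)) (1 + |Q|)² |Q|^{1/n + 1/q_+(Q) − 1/p_-(Q)} ‖∇f‖_{L^{p(·)}(Q)}, where f_Q = |Q|^{-1}∫_Q f dx; moreover, in case (i) the constant can be taken of the form C(n)·q_+(Q) with C(n) depending only on n. -/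

import Mathlib

open MeasureTheory Metric Set Filter Topology

noncomputable section

abbrev Eucl (n : ℕ) : Type := EuclideanSpace ℝ (Fin n)

/-- Essential supremum of `p` over the set `A` (w.r.t. Lebesgue measure). -/
def essSupOn {n : ℕ} (p : Eucl n → ℝ) (A : Set (Eucl n)) : ℝ :=
  essSup p (volume.restrict A)

/-- Essential infimum of `p` over the set `A` (w.r.t. Lebesgue measure). -/
def essInfOn {n : ℕ} (p : Eucl n → ℝ) (A : Set (Eucl n)) : ℝ :=
  essInf p (volume.restrict A)

/-- The Luxemburg norm of `f` on `A` with variable exponent `p`. -/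
def luxNorm {n : ℕ} (A : Set (Eucl n)) (p f : Eucl n → ℝ) : ℝ :=
  sInf {l : ℝ | 0 < l ∧ (∫⁻ x in A, ENNReal.ofReal ((|f x| / l) ^ (p x))) ≤ 1}

/-- `f` belongs to the variable Lebesgue space `L^{p(·)}(A)`. -/
def MemVarLp {n : ℕ} (A : Set (Eucl n)) (p f : Eucl n → ℝ) : Prop :=
  ∃ l : ℝ, 0 < l ∧ (∫⁻ x in A, ENNReal.ofReal ((|f x| / l) ^ (p x))) ≤ 1

/-- `d(x) = dist(x, ∂Ω)`. -/
def bdist {n : ℕ} (Ω : Set (Eucl n)) (x : Eucl n) : ℝ :=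
  infDist x (frontier Ω)

/-- The ball `B_{x,τ} = B(x, τ d(x))`. -/
def ballB {n : ℕ} (Ω : Set (Eucl n)) (τ : ℝ) (x : Eucl n) : Set (Eucl n) :=
  ball x (τ * bdist Ω x)

/-- The boundary log-Hölder condition `∂LH₀^τ(Ω)` with constant `C₀`. -/
def BoundaryLH {n : ℕ} (Ω : Set (Eucl n)) (p : Eucl n → ℝ) (τ C₀ : ℝ) : Prop :=
  ∀ x ∈ Ω, τ * bdist Ω x ≤ 1 / 2 →
    essSupOn p (ballB Ω τ x ∩ Ω) - essInfOn p (ballB Ω τ x ∩ Ω)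
      ≤ C₀ / (-Real.log (τ * bdist Ω x))

/-- `Ω` is a John domain with parameter `lam`. -/
def JohnDomain {n : ℕ} (Ω : Set (Eucl n)) (lam : ℝ) : Prop :=
  ∃ x₀ ∈ Ω, ∀ y ∈ Ω, ∃ ℓ : ℝ, 0 ≤ ℓ ∧ ∃ γ : ℝ → Eucl n,
    γ 0 = y ∧ γ ℓ = x₀ ∧ (∀ t ∈ Icc (0:ℝ) ℓ, γ t ∈ Ω) ∧
    LipschitzOnWith 1 γ (Icc (0:ℝ) ℓ) ∧
    ∀ t ∈ Icc (0:ℝ) ℓ, t ≤ lam * infDist (γ t) (frontier Ω)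

/-- `g` is uniformly `ε`-continuous on `S`. -/
def UnifEpsCont {n : ℕ} (S : Set (Eucl n)) (g : Eucl n → ℝ) (ε : ℝ) : Prop :=
  ∃ δ : ℝ, 0 < δ ∧ ∀ x ∈ S, ∀ y ∈ S, dist x y < δ → |g y - g x| < ε

/-- `f` is locally Lipschitz on `S`. -/
def LocLipschitzOn {n : ℕ} (S : Set (Eucl n)) (f : Eucl n → ℝ) : Prop :=
  ∀ x ∈ S, ∃ K : NNReal, ∃ t ∈ 𝓝 x, LipschitzOnWith K f (t ∩ S)

/-- The average of `f` over `A`. -/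
def avgOn {n : ℕ} (A : Set (Eucl n)) (f : Eucl n → ℝ) : ℝ :=
  (volume A).toReal⁻¹ * ∫ x in A, f x

/-- The pointwise dual (conjugate) exponent `p'`, `1/p + 1/p' = 1`. -/
def dualExp {α : Type*} (p : α → ℝ) : α → ℝ :=
  fun x => p x / (p x - 1)

/-- The norm of the a.e.-defined gradient of `f`. -/
def gradNorm {n : ℕ} (f : Eucl n → ℝ) : Eucl n → ℝ :=
  fun x => ‖fderiv ℝ f x‖

/-- The closed cube with center `c` and half side length `r`. -/
def closedCube {n : ℕ} (c : Eucl n) (r : ℝ) : Set (Eucl n) :=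
  {x | ∀ i, |x i - c i| ≤ r}

section ProductMeasure

variable {ι : Type*} [Fintype ι] [DecidableEq ι] {X : ι → Type*} [∀ i, MeasurableSpace (X i)]

open Function

/-- Resampling one coordinate multiplies the integral by the total mass of that coordinate. -/
theorem lintegral_pi_lintegral_update (μ : ∀ i, Measure (X i)) [∀ i, SigmaFinite (μ i)]
    {g : (∀ i, X i) → ENNReal} (hg : Measurable g) (i : ι) :
    ∫⁻ x, ∫⁻ s, g (update x i s) ∂μ i ∂Measure.pi μ
      = μ i univ * ∫⁻ x, g x ∂Measure.pi μ := by
  rcases isEmpty_or_nonempty (∀ i, X i) with h | ⟨⟨x₀⟩⟩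
  · simp
  have hm : Measurable fun x => ∫⁻ s, g (update x i s) ∂μ i := by
    have := hg.lmarginal μ (s := {i})
    rwa [lmarginal_singleton] at this
  rw [lintegral_eq_lmarginal_univ (f := fun x => ∫⁻ s, g (update x i s) ∂μ i) x₀,
    lintegral_eq_lmarginal_univ (f := g) x₀, lmarginal_erase' _ hm (Finset.mem_univ i),
    lmarginal_erase' _ hg (Finset.mem_univ i)]
  simp only [update_idem, lintegral_const]
  rw [mul_comm]
  exact lintegral_mul_const _ (hm.comp measurable_updateFinset)

/-- A null property of the product holds for almost every value of a resampled coordinate. -/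
theorem ae_ae_update_of_ae_pi (μ : ∀ i, Measure (X i)) [∀ i, SigmaFinite (μ i)]
    {P : (∀ i, X i) → Prop} (h : ∀ᵐ x ∂Measure.pi μ, P x) (i : ι) :
    ∀ᵐ x ∂Measure.pi μ, ∀ᵐ s ∂μ i, P (update x i s) := by
  obtain ⟨t, ht, htm, ht0⟩ := exists_measurable_superset_of_null (ae_iff.1 h)
  have hg : Measurable (t.indicator (fun _ => (1 : ENNReal))) := measurable_const.indicator htm
  have hm : Measurable fun x => ∫⁻ s, t.indicator (fun _ => (1 : ENNReal)) (update x i s) ∂μ i := by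
    have := hg.lmarginal μ (s := {i})
    rwa [lmarginal_singleton] at this
  have h0 := lintegral_pi_lintegral_update μ hg i
  rw [lintegral_indicator_const htm, ht0, mul_zero, mul_zero, lintegral_eq_zero_iff hm] at h0
  filter_upwards [h0] with x hx
  filter_upwards [(lintegral_eq_zero_iff (hg.comp (measurable_update x))).1 hx] with s hs
  by_contra hP
  simp [indicator_of_mem (ht hP)] at hs

end ProductMeasure

section Swap

variable {ι : Type*} [Fintype ι] [DecidableEq ι] {E : Type*} [MeasurableSpace E]

/-- Exchanging the coordinates in `s` between two independent copies preserves the measure. -/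
theorem measurePreserving_piecewise_swap (μ : ι → Measure E) [∀ i, SigmaFinite (μ i)]
    (s : Finset ι) :
    MeasurePreserving (fun z : (ι → E) × (ι → E) => (s.piecewise z.2 z.1, s.piecewise z.1 z.2))
      ((Measure.pi μ).prod (Measure.pi μ)) ((Measure.pi μ).prod (Measure.pi μ)) := by
  have h1 := measurePreserving_arrowProdEquivProdArrow E E ι μ μ
  have h2 : MeasurePreserving
      (fun (z : ι → E × E) i => (if i ∈ s then Prod.swap else id : E × E → E × E) (z i))
      (Measure.pi fun i => (μ i).prod (μ i)) (Measure.pi fun i => (μ i).prod (μ i)) := by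
    refine measurePreserving_pi _ _ fun i => ?_
    split_ifs
    · exact Measure.measurePreserving_swap
    · exact MeasurePreserving.id _
  convert! h1.comp (h2.comp (h1.symm _)) using 1
  ext z i
  · by_cases hi : i ∈ s <;>
      simp [hi, MeasurableEquiv.arrowProdEquivProdArrow, Equiv.arrowProdEquivProdArrow]
  · by_cases hi : i ∈ s <;>
      simp [hi, MeasurableEquiv.arrowProdEquivProdArrow, Equiv.arrowProdEquivProdArrow]

end Swap

section BoxSobolev

variable {ι : Type*} [Fintype ι] [DecidableEq ι]

open Function

theorem lintegral_piecewise_sub_le (μ : ι → Measure ℝ) [∀ i, IsFiniteMeasure (μ i)]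
    {ℓ : ENNReal} (hℓ : ∀ i, μ i univ = ℓ) {u : (ι → ℝ) → ℝ} (hu : Measurable u)
    {D : (ι → ℝ) → ENNReal} (hD : Measurable D)
    (h : ∀ i, ∀ᵐ x ∂Measure.pi μ, ∀ᵐ t ∂μ i,
      ‖u x - u (update x i t)‖ₑ ≤ ∫⁻ s, D (update x i s) ∂μ i) (s : Finset ι) :
    ∫⁻ z, ‖u z.1 - u (s.piecewise z.2 z.1)‖ₑ ∂(Measure.pi μ).prod (Measure.pi μ)
      ≤ s.card * (ℓ * (∫⁻ x, D x ∂Measure.pi μ) * Measure.pi μ univ) := by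
  induction s using Finset.induction_on with
  | empty => simp
  | insert i s hi ih =>
    have hT := measurePreserving_piecewise_swap μ s
    have hup : Measurable fun z : (ι → ℝ) × (ι → ℝ) => update z.1 i (z.2 i) :=
      measurable_update'.comp (measurable_fst.prodMk ((measurable_pi_apply i).comp measurable_snd))
    have hΦ : Measurable fun z : (ι → ℝ) × (ι → ℝ) => ‖u z.1 - u (update z.1 i (z.2 i))‖ₑ :=
      ((hu.comp measurable_fst).sub (hu.comp hup)).enorm
    have hm : Measurable fun z : (ι → ℝ) × (ι → ℝ) => ‖u z.1 - u (s.piecewise z.2 z.1)‖ₑ :=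
      ((hu.comp measurable_fst).sub (hu.comp (measurable_fst.comp hT.measurable))).enorm
    have hstep : ∫⁻ z, ‖u (s.piecewise z.2 z.1) - u (update (s.piecewise z.2 z.1) i (z.2 i))‖ₑ
        ∂(Measure.pi μ).prod (Measure.pi μ)
          ≤ ℓ * (∫⁻ x, D x ∂Measure.pi μ) * Measure.pi μ univ := by
      have hcomp := hT.lintegral_comp hΦ
      simp only [Finset.piecewise_eq_of_notMem _ _ _ hi] at hcomp
      rw [hcomp, lintegral_prod _ hΦ.aemeasurable]
      calc ∫⁻ x, ∫⁻ y, ‖u x - u (update x i (y i))‖ₑ ∂Measure.pi μ ∂Measure.pi μ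
          ≤ ∫⁻ x, (∫⁻ s, D (update x i s) ∂μ i) * Measure.pi μ univ ∂Measure.pi μ := by
            refine lintegral_mono_ae ?_
            filter_upwards [h i] with x hx
            rw [← lintegral_const]
            exact lintegral_mono_ae ((Measure.tendsto_eval_ae_ae (i := i)).eventually hx)
        _ = ℓ * (∫⁻ x, D x ∂Measure.pi μ) * Measure.pi μ univ := by
            have hmD : Measurable fun x => ∫⁻ s, D (update x i s) ∂μ i := by
              have := hD.lmarginal μ (s := {i})
              rwa [lmarginal_singleton] at this
            rw [lintegral_mul_const _ hmD, lintegral_pi_lintegral_update μ hD i, hℓ]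
    calc ∫⁻ z, ‖u z.1 - u ((insert i s).piecewise z.2 z.1)‖ₑ ∂(Measure.pi μ).prod (Measure.pi μ)
        ≤ ∫⁻ z, ‖u z.1 - u (s.piecewise z.2 z.1)‖ₑ
            + ‖u (s.piecewise z.2 z.1) - u (update (s.piecewise z.2 z.1) i (z.2 i))‖ₑ
            ∂(Measure.pi μ).prod (Measure.pi μ) := by
          refine lintegral_mono fun z => ?_
          rw [Finset.piecewise_insert,
            ← sub_add_sub_cancel (u z.1) (u (s.piecewise z.2 z.1))]
          exact enorm_add_le _ _
      _ ≤ _ := by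
          rw [lintegral_add_left hm, Finset.card_insert_of_notMem hi, Nat.cast_add_one, add_mul,
            one_mul]
          gcongr

/-- The `L¹` Poincaré inequality for mean zero functions on a box. -/
theorem lintegral_enorm_le_of_integral_eq_zero (μ : ι → Measure ℝ) [∀ i, IsFiniteMeasure (μ i)]
    {ℓ : ENNReal} (hℓ0 : ℓ ≠ 0) (hℓ : ∀ i, μ i univ = ℓ) {u : (ι → ℝ) → ℝ} (hu : Measurable u)
    (hui : Integrable u (Measure.pi μ)) (hu0 : ∫ x, u x ∂Measure.pi μ = 0)
    {D : (ι → ℝ) → ENNReal} (hD : Measurable D)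
    (h : ∀ i, ∀ᵐ x ∂Measure.pi μ, ∀ᵐ t ∂μ i,
      ‖u x - u (update x i t)‖ₑ ≤ ∫⁻ s, D (update x i s) ∂μ i) :
    ∫⁻ x, ‖u x‖ₑ ∂Measure.pi μ ≤ Fintype.card ι * (ℓ * ∫⁻ x, D x ∂Measure.pi μ) := by
  have hV0 : Measure.pi μ univ ≠ 0 := by
    rw [Measure.pi_univ]; exact Finset.prod_ne_zero_iff.2 fun i _ => by rwa [hℓ]
  refine (ENNReal.mul_le_mul_iff_left hV0 (measure_ne_top _ _)).1 ?_
  have key := lintegral_piecewise_sub_le μ hℓ hu hD h Finset.univ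
  simp only [Finset.piecewise_univ, Finset.card_univ] at key
  have hm : Measurable fun z : (ι → ℝ) × (ι → ℝ) => ‖u z.1 - u z.2‖ₑ :=
    ((hu.comp measurable_fst).sub (hu.comp measurable_snd)).enorm
  rw [lintegral_prod _ hm.aemeasurable] at key
  calc (∫⁻ x, ‖u x‖ₑ ∂Measure.pi μ) * Measure.pi μ univ
      = ∫⁻ x, ‖u x‖ₑ * Measure.pi μ univ ∂Measure.pi μ := by
        rw [lintegral_mul_const _ hu.enorm]
    _ ≤ ∫⁻ x, ∫⁻ y, ‖u x - u y‖ₑ ∂Measure.pi μ ∂Measure.pi μ := by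
        refine lintegral_mono fun x => ?_
        refine le_trans (le_of_eq ?_) (enorm_integral_le_lintegral_enorm fun y => u x - u y)
        rw [integral_sub (integrable_const _) hui, hu0, sub_zero, integral_const, smul_eq_mul,
          enorm_mul, mul_comm, Measure.real, Real.enorm_of_nonneg ENNReal.toReal_nonneg,
          ENNReal.ofReal_toReal (measure_ne_top _ _)]
    _ ≤ _ := by rw [mul_assoc]; exact key

/-- The Sobolev inequality with exponents `1` and `n / (n - 1)` for mean zero functions on a box
with equal sides, stated for an upper gradient `D` along coordinate lines. -/
theorem lintegral_enorm_rpow_le_of_integral_eq_zero (μ : ι → Measure ℝ)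
    [∀ i, IsFiniteMeasure (μ i)]
    {ℓ : ENNReal} (hℓ0 : ℓ ≠ 0) (hℓ : ∀ i, μ i univ = ℓ) {u : (ι → ℝ) → ℝ} (hu : Measurable u)
    (hui : Integrable u (Measure.pi μ)) (hu0 : ∫ x, u x ∂Measure.pi μ = 0)
    {D : (ι → ℝ) → ENNReal} (hD : Measurable D)
    (h : ∀ i, ∀ᵐ x ∂Measure.pi μ, ∀ᵐ t ∂μ i,
      ‖u x - u (update x i t)‖ₑ ≤ ∫⁻ s, D (update x i s) ∂μ i)
    {p : ℝ} (hp : Real.HolderConjugate (Fintype.card ι) p) :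
    ∫⁻ x, ‖u x‖ₑ ^ p ∂Measure.pi μ
      ≤ ((Fintype.card ι + 1) * ∫⁻ x, D x ∂Measure.pi μ) ^ p := by
  have hn1 : (1 : ℝ) < Fintype.card ι := hp.lt
  have hι : Nonempty ι := by
    rw [← Fintype.card_pos_iff]; exact_mod_cast zero_lt_one.trans hn1
  have hℓt : ℓ ≠ ⊤ := hℓ (Classical.arbitrary ι) ▸ measure_ne_top _ _
  set F : (ι → ℝ) → ENNReal := fun x => D x + ℓ⁻¹ * ‖u x‖ₑ with hF
  have hFm : Measurable F := hD.add (hu.enorm.const_mul _)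
  have hline : ∀ᵐ x ∂Measure.pi μ, ∀ i, ‖u x‖ₑ ≤ ∫⁻ s, F (update x i s) ∂μ i := by
    rw [ae_all_iff]
    intro i
    filter_upwards [h i] with x hx
    have hum : Measurable fun s => ‖u (update x i s)‖ₑ := (hu.comp (measurable_update x)).enorm
    have h1 : ‖u x‖ₑ * ℓ
        ≤ ∫⁻ t, (‖u (update x i t)‖ₑ + ∫⁻ s, D (update x i s) ∂μ i) ∂μ i := by
      rw [← hℓ i, ← lintegral_const]
      refine lintegral_mono_ae ?_
      filter_upwards [hx] with t ht
      calc ‖u x‖ₑ = ‖u (update x i t) + (u x - u (update x i t))‖ₑ := by ring_nf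
        _ ≤ _ := (enorm_add_le _ _).trans (by gcongr)
    rw [lintegral_add_left hum, lintegral_const, hℓ] at h1
    have hDm : Measurable fun s => D (update x i s) := hD.comp (measurable_update x)
    simp only [hF]
    rw [lintegral_add_left hDm, lintegral_const_mul _ hum]
    calc ‖u x‖ₑ = ℓ⁻¹ * (‖u x‖ₑ * ℓ) := by
          rw [mul_left_comm, ENNReal.inv_mul_cancel hℓ0 hℓt, mul_one]
      _ ≤ ℓ⁻¹ * (∫⁻ s, ‖u (update x i s)‖ₑ ∂μ i + (∫⁻ s, D (update x i s) ∂μ i) * ℓ) := by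
          gcongr
      _ = _ := by
          rw [mul_add, mul_left_comm, ENNReal.inv_mul_cancel hℓ0 hℓt, mul_one, add_comm]
  calc ∫⁻ x, ‖u x‖ₑ ^ p ∂Measure.pi μ
      ≤ ∫⁻ x, ∏ i, (∫⁻ s, F (update x i s) ∂μ i) ^ ((1 : ℝ) / (Fintype.card ι - 1 : ℝ))
          ∂Measure.pi μ := by
        refine lintegral_mono_ae ?_
        filter_upwards [hline] with x hx
        calc ‖u x‖ₑ ^ p
            = ∏ _i : ι, ‖u x‖ₑ ^ ((1 : ℝ) / (Fintype.card ι - 1 : ℝ)) := by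
              rw [Finset.prod_const, Finset.card_univ, ← ENNReal.rpow_natCast, ← ENNReal.rpow_mul,
                hp.conjugate_eq]
              congr 1
              ring
          _ ≤ _ := by
              refine Finset.prod_le_prod' fun i _ => ENNReal.rpow_le_rpow (hx i) ?_
              have : (0 : ℝ) < Fintype.card ι - 1 := by linarith
              positivity
    _ ≤ (∫⁻ x, F x ∂Measure.pi μ) ^ p := lintegral_prod_lintegral_pow_le μ hp hFm
    _ ≤ _ := by
        refine ENNReal.rpow_le_rpow ?_ hp.symm.nonneg
        rw [hF, lintegral_add_left hD, lintegral_const_mul _ hu.enorm, add_mul, one_mul, add_comm]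
        refine add_le_add_left ?_ _
        calc ℓ⁻¹ * ∫⁻ x, ‖u x‖ₑ ∂Measure.pi μ
            ≤ ℓ⁻¹ * (Fintype.card ι * (ℓ * ∫⁻ x, D x ∂Measure.pi μ)) := by
              gcongr
              exact lintegral_enorm_le_of_integral_eq_zero μ hℓ0 hℓ hu hui hu0 hD h
          _ = _ := by
              rw [mul_left_comm, ← mul_assoc ℓ⁻¹, ENNReal.inv_mul_cancel hℓ0 hℓt, one_mul]

end BoxSobolev

section Cube

variable {n : ℕ}

open Function

theorem closedCube_eq_preimage (c : Eucl n) (r : ℝ) :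
    closedCube c r = WithLp.ofLp ⁻¹' (univ.pi fun i => Icc (c i - r) (c i + r)) := by
  ext x
  simp only [closedCube, mem_ofPred_eq, mem_preimage, mem_univ_pi, mem_Icc, abs_le]
  exact forall_congr' fun i => by constructor <;> rintro ⟨h₁, h₂⟩ <;> constructor <;> linarith

theorem isClosed_closedCube (c : Eucl n) (r : ℝ) : IsClosed (closedCube c r) := by
  rw [closedCube_eq_preimage]
  exact (isClosed_set_pi fun i _ => isClosed_Icc).preimage (PiLp.continuous_ofLp 2 _)

theorem convex_closedCube (c : Eucl n) (r : ℝ) : Convex ℝ (closedCube c r) := by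
  rw [closedCube_eq_preimage]
  exact (convex_pi fun i _ => convex_Icc _ _).linear_preimage
    (WithLp.linearEquiv 2 ℝ (Fin n → ℝ)).toLinearMap

theorem isCompact_closedCube (c : Eucl n) (r : ℝ) : IsCompact (closedCube c r) := by
  rw [closedCube_eq_preimage]
  exact (PiLp.homeomorph 2 fun _ : Fin n => ℝ).isClosedEmbedding.isCompact_preimage
    (isCompact_univ_pi fun i => isCompact_Icc)

theorem mem_closedCube_self (c : Eucl n) {r : ℝ} (hr : 0 ≤ r) : c ∈ closedCube c r := by
  simpa [closedCube] using fun _ => hr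

theorem measurePreserving_toLp_closedCube (c : Eucl n) (r : ℝ) :
    MeasurePreserving (WithLp.toLp 2)
      (Measure.pi fun i => (volume : Measure ℝ).restrict (Icc (c i - r) (c i + r)))
      (volume.restrict (closedCube c r)) := by
  have h := (PiLp.volume_preserving_toLp (Fin n)).restrict_preimage
    (isClosed_closedCube c r).measurableSet
  rw [closedCube_eq_preimage, ← preimage_comp] at h
  rw [← Measure.restrict_pi_pi, closedCube_eq_preimage]
  exact h

theorem volume_closedCube_ne_zero (c : Eucl n) {r : ℝ} (hr : 0 < r) :
    volume (closedCube c r) ≠ 0 := by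
  have h := (measurePreserving_toLp_closedCube c r).measure_preimage (s := univ)
    MeasurableSet.univ.nullMeasurableSet
  rw [Measure.restrict_apply_univ, preimage_univ, Measure.pi_univ] at h
  rw [← h]
  exact Finset.prod_ne_zero_iff.2 fun i _ => by simp; linarith

theorem ae_closedCube_mem_nhds (c : Eucl n) (r : ℝ) :
    ∀ᵐ x ∂(volume.restrict (closedCube c r)), closedCube c r ∈ 𝓝 x := by
  have h0 : volume (frontier (closedCube c r)) = 0 := (convex_closedCube c r).addHaar_frontier _
  filter_upwards [ae_restrict_mem (isClosed_closedCube c r).measurableSet,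
    ae_restrict_of_ae (measure_eq_zero_iff_ae_notMem.1 h0)] with x hx hxf
  rw [← mem_interior_iff_mem_nhds]
  by_contra hxi
  exact hxf ⟨subset_closure hx, hxi⟩

theorem toLp_update_eq (x : Fin n → ℝ) (i : Fin n) (s : ℝ) :
    WithLp.toLp 2 (update x i s)
      = WithLp.toLp 2 x + (s - x i) • EuclideanSpace.single i (1 : ℝ) := by
  ext j
  by_cases hj : j = i
  · subst hj; simp
  · simp [hj]

/-- Along almost every coordinate line, the oscillation of a Lipschitz function is controlled by
the integral of the norm of its derivative. -/
theorem ae_enorm_sub_update_le (c : Eucl n) (r : ℝ) {K : NNReal} {f : Eucl n → ℝ}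
    (hf : LipschitzWith K f) (i : Fin n) :
    ∀ᵐ x ∂(Measure.pi fun i => (volume : Measure ℝ).restrict (Icc (c i - r) (c i + r))),
      ∀ᵐ t ∂(volume : Measure ℝ).restrict (Icc (c i - r) (c i + r)),
        ‖f (WithLp.toLp 2 x) - f (WithLp.toLp 2 (update x i t))‖ₑ
          ≤ ∫⁻ s in Icc (c i - r) (c i + r), ‖fderiv ℝ f (WithLp.toLp 2 (update x i s))‖ₑ := by
  have hd : ∀ᵐ x ∂(Measure.pi fun i => (volume : Measure ℝ).restrict (Icc (c i - r) (c i + r))),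
      DifferentiableAt ℝ f (WithLp.toLp 2 x) :=
    (measurePreserving_toLp_closedCube c r).quasiMeasurePreserving.ae
      (ae_restrict_of_ae hf.ae_differentiableAt)
  have hmem : ∀ᵐ x ∂(Measure.pi fun i => (volume : Measure ℝ).restrict (Icc (c i - r) (c i + r))),
      x i ∈ Icc (c i - r) (c i + r) :=
    (Measure.tendsto_eval_ae_ae (i := i)).eventually (ae_restrict_mem measurableSet_Icc)
  filter_upwards [ae_ae_update_of_ae_pi _ hd i, hmem] with x hx hxi
  filter_upwards [ae_restrict_mem measurableSet_Icc] with t ht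
  set g : ℝ → ℝ := fun s => f (WithLp.toLp 2 (update x i s)) with hg
  have hgl : LipschitzWith K g := by
    refine LipschitzWith.of_dist_le_mul fun s s' => (hf.dist_le_mul _ _).trans (le_of_eq ?_)
    rw [toLp_update_eq, toLp_update_eq, dist_add_left, dist_eq_norm, ← sub_smul, norm_smul]
    simp [Real.dist_eq]
  have hftc := (hgl.lipschitzOnWith (s := uIcc t (x i))).absolutelyContinuousOnInterval
    |>.integral_deriv_eq_sub
  have hgx : f (WithLp.toLp 2 x) = g (x i) := by simp [hg]
  rw [hgx, ← hftc]
  have hsub : uIoc t (x i) ⊆ Icc (c i - r) (c i + r) :=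
    uIoc_subset_uIcc.trans ((ordConnected_Icc).uIcc_subset ht hxi)
  calc ‖∫ s in t..(x i), deriv g s‖ₑ
      = ‖∫ s in uIoc t (x i), deriv g s‖ₑ := by
        rw [← ofReal_norm, ← ofReal_norm, intervalIntegral.norm_intervalIntegral_eq]
    _ ≤ ∫⁻ s in uIoc t (x i), ‖deriv g s‖ₑ := enorm_integral_le_lintegral_enorm _
    _ ≤ ∫⁻ s in Icc (c i - r) (c i + r), ‖deriv g s‖ₑ := lintegral_mono_set hsub
    _ ≤ _ := by
        refine lintegral_mono_ae ?_
        filter_upwards [hx] with s hs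
        have hl : HasDerivAt (fun s => WithLp.toLp 2 (update x i s))
            (EuclideanSpace.single i (1 : ℝ)) s := by
          simp only [toLp_update_eq]
          simpa using (((hasDerivAt_id s).sub_const (x i)).smul_const
            (EuclideanSpace.single i (1 : ℝ))).const_add (WithLp.toLp 2 x)
        have hgd : HasDerivAt g (fderiv ℝ f (WithLp.toLp 2 (update x i s))
            (EuclideanSpace.single i (1 : ℝ))) s := hs.hasFDerivAt.comp_hasDerivAt s hl
        rw [hgd.deriv, ← ofReal_norm, ← ofReal_norm]
        refine ENNReal.ofReal_le_ofReal ((ContinuousLinearMap.le_opNorm _ _).trans ?_)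
        simp

theorem measurable_enorm_fderiv (f : Eucl n → ℝ) : Measurable fun x => ‖fderiv ℝ f x‖ₑ :=
  (measurable_fderiv ℝ f).enorm

theorem lintegral_cube_rpow_le_of_lipschitzWith (c : Eucl n) {r : ℝ} (hr : 0 < r)
    {K : NNReal} {f : Eucl n → ℝ} (hf : LipschitzWith K f)
    (hf0 : ∫ x in closedCube c r, f x = 0) {p : ℝ} (hp : Real.HolderConjugate n p) :
    ∫⁻ x in closedCube c r, ‖f x‖ₑ ^ p
      ≤ ((n + 1) * ∫⁻ x in closedCube c r, ‖fderiv ℝ f x‖ₑ) ^ p := by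
  have hT := measurePreserving_toLp_closedCube c r
  have hemb : MeasurableEmbedding (WithLp.toLp 2 : (Fin n → ℝ) → Eucl n) :=
    (MeasurableEquiv.toLp 2 (Fin n → ℝ)).measurableEmbedding
  have hfi : IntegrableOn f (closedCube c r) volume :=
    hf.continuous.continuousOn.integrableOn_compact (isCompact_closedCube c r)
  rw [← hT.lintegral_comp_emb hemb, ← hT.lintegral_comp_emb hemb]
  have hp' : Real.HolderConjugate (Fintype.card (Fin n)) p := by simpa using hp
  have key := lintegral_enorm_rpow_le_of_integral_eq_zero
    (fun i => (volume : Measure ℝ).restrict (Icc (c i - r) (c i + r)))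
    (ℓ := ENNReal.ofReal (2 * r)) (by simpa using hr)
    (fun i => by rw [Measure.restrict_apply_univ, Real.volume_Icc]; ring_nf) (u := fun x => f (WithLp.toLp 2 x))
    (hf.continuous.measurable.comp hT.measurable)
    (hT.integrable_comp_of_integrable hfi) (by rwa [hT.integral_comp hemb])
    (D := fun x => ‖fderiv ℝ f (WithLp.toLp 2 x)‖ₑ)
    ((measurable_enorm_fderiv f).comp hT.measurable)
    (fun i => ae_enorm_sub_update_le c r hf i) hp'
  simpa using key

/-- The Sobolev–Poincaré inequality with exponents `1` and `n / (n - 1)` on a cube. -/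
theorem lintegral_cube_rpow_le_of_lipschitzOnWith (c : Eucl n) {r : ℝ} (hr : 0 < r)
    {K : NNReal} {f : Eucl n → ℝ} (hf : LipschitzOnWith K f (closedCube c r))
    (hf0 : ∫ x in closedCube c r, f x = 0) {p : ℝ} (hp : Real.HolderConjugate n p) :
    ∫⁻ x in closedCube c r, ‖f x‖ₑ ^ p
      ≤ ((n + 1) * ∫⁻ x in closedCube c r, ‖fderiv ℝ f x‖ₑ) ^ p := by
  obtain ⟨g, hg, hfg⟩ := hf.extend_real
  have hQm := (isClosed_closedCube c r).measurableSet
  have hd : ∀ᵐ x ∂(volume.restrict (closedCube c r)),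
      ‖fderiv ℝ f x‖ₑ = ‖fderiv ℝ g x‖ₑ := by
    filter_upwards [ae_closedCube_mem_nhds c r] with x hx
    rw [(hfg.eventuallyEq_of_mem hx).fderiv_eq]
  rw [setLIntegral_congr_fun hQm (g := fun x => ‖g x‖ₑ ^ p) (fun x hx => by simp only [hfg hx]),
    lintegral_congr_ae hd]
  refine lintegral_cube_rpow_le_of_lipschitzWith c hr hg ?_ hp
  rwa [← setIntegral_congr_fun hQm hfg]

end Cube

section SignedPower

/-- The signed power `y ↦ y |y| ^ (γ - 1)` is differentiable for `1 ≤ γ`. -/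
theorem hasDerivAt_mul_abs_rpow {γ : ℝ} (hγ : 1 ≤ γ) (y : ℝ) :
    HasDerivAt (fun y : ℝ => y * |y| ^ (γ - 1)) (γ * |y| ^ (γ - 1)) y := by
  rcases hγ.eq_or_lt with rfl | hγ
  · simpa using hasDerivAt_id' y
  rcases eq_or_ne y 0 with rfl | hy
  · rw [hasDerivAt_iff_tendsto_slope, abs_zero, Real.zero_rpow (by linarith), mul_zero]
    have hc : Tendsto (fun y : ℝ => |y| ^ (γ - 1)) (𝓝[≠] 0) (𝓝 0) := by
      have : Continuous fun y : ℝ => |y| ^ (γ - 1) :=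
        continuous_abs.rpow_const fun _ => Or.inr (by linarith)
      have h0 := this.tendsto 0
      rw [abs_zero, Real.zero_rpow (by linarith)] at h0
      exact h0.mono_left nhdsWithin_le_nhds
    refine hc.congr' ?_
    filter_upwards [self_mem_nhdsWithin] with z hz
    rw [slope_def_field]
    field_simp [show z ≠ 0 from hz]
    simp
  · have h := (hasDerivAt_id y).mul ((hasDerivAt_abs hy).rpow_const (p := γ - 1)
      (Or.inl (abs_ne_zero.2 hy)))
    refine h.congr_deriv ?_
    have h1 : |y| ^ (γ - 1 - 1) * |y| = |y| ^ (γ - 1) := by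
      rw [Real.rpow_sub_one (abs_ne_zero.2 hy), div_mul_cancel₀ _ (abs_ne_zero.2 hy)]
    have h2 : y * (SignType.sign y : ℝ) = |y| := self_mul_sign y
    simp only [id_eq, one_mul]
    calc _ = |y| ^ (γ - 1) + (γ - 1) * (|y| ^ (γ - 1 - 1) * (y * (SignType.sign y : ℝ))) := by ring
      _ = _ := by rw [h2, h1]; ring

theorem abs_mul_abs_rpow {γ : ℝ} (hγ : 1 ≤ γ) (y : ℝ) : |y * |y| ^ (γ - 1)| = |y| ^ γ := by
  rw [abs_mul, abs_of_nonneg (Real.rpow_nonneg (abs_nonneg y) _)]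
  rw [← Real.rpow_one_add' (abs_nonneg y) (by linarith), add_sub_cancel]

theorem continuous_mul_abs_rpow {γ : ℝ} (hγ : 1 ≤ γ) :
    Continuous fun y : ℝ => y * |y| ^ (γ - 1) :=
  continuous_iff_continuousAt.2 fun y => (hasDerivAt_mul_abs_rpow hγ y).continuousAt

theorem lipschitzOnWith_mul_abs_rpow {γ R : ℝ} (hγ : 1 ≤ γ) :
    LipschitzOnWith (γ * R ^ (γ - 1)).toNNReal (fun y : ℝ => y * |y| ^ (γ - 1)) (Icc (-R) R) := by
  refine (convex_Icc _ _).lipschitzOnWith_of_nnnorm_hasDerivWithin_le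
    (fun y _ => (hasDerivAt_mul_abs_rpow hγ y).hasDerivWithinAt) fun y hy => ?_
  have h : 0 ≤ γ * |y| ^ (γ - 1) := by positivity
  rw [← NNReal.coe_le_coe, coe_nnnorm, Real.norm_of_nonneg h]
  refine le_trans ?_ (Real.le_coe_toNNReal _)
  gcongr
  exact abs_le.2 hy

/-- A function bounded on a finite measure space has a centre of mass of every order `γ`. -/
theorem exists_integral_signedPow_eq_zero {α : Type*} [MeasurableSpace α] (μ : Measure α)
    [IsFiniteMeasure μ] {f : α → ℝ} (hf : AEStronglyMeasurable f μ) {R : ℝ}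
    (hR : ∀ᵐ x ∂μ, |f x| ≤ R) (hR0 : 0 ≤ R) {γ : ℝ} (hγ : 1 ≤ γ) :
    ∃ m ∈ Icc (-R) R, ∫ x, (f x - m) * |f x - m| ^ (γ - 1) ∂μ = 0 := by
  have hc : ContinuousOn (fun m => ∫ x, (f x - m) * |f x - m| ^ (γ - 1) ∂μ) (Icc (-R) R) := by
    refine continuousOn_of_dominated (bound := fun _ => (2 * R) ^ γ) (fun m _ => ?_)
      (fun m hm => ?_) (integrable_const _) (ae_of_all _ fun x => ?_)
    · exact (continuous_mul_abs_rpow hγ).comp_aestronglyMeasurable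
        (hf.sub aestronglyMeasurable_const)
    · filter_upwards [hR] with x hx
      rw [Real.norm_eq_abs, abs_mul_abs_rpow hγ]
      gcongr
      have := abs_sub (f x) m
      have := abs_le.2 hm
      linarith
    · exact ((continuous_mul_abs_rpow hγ).comp (continuous_const.sub continuous_id)).continuousOn
  have hneg : ∫ x, (f x - R) * |f x - R| ^ (γ - 1) ∂μ ≤ 0 := by
    refine integral_nonpos_of_ae ?_
    filter_upwards [hR] with x hx
    exact mul_nonpos_of_nonpos_of_nonneg (by linarith [(abs_le.1 hx).2]) (by positivity)
  have hpos : 0 ≤ ∫ x, (f x - -R) * |f x - -R| ^ (γ - 1) ∂μ := by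
    refine integral_nonneg_of_ae ?_
    filter_upwards [hR] with x hx
    exact mul_nonneg (by linarith [(abs_le.1 hx).1]) (by positivity)
  exact intermediate_value_Icc' (by linarith) hc ⟨hneg, hpos⟩

end SignedPower

section SobolevPoincare

variable {n : ℕ}

/-- The Sobolev–Poincaré inequality on a cube at the critical exponents `1 / t = 1 / s + 1 / n`,
with an unspecified centring constant. -/
theorem exists_lintegral_cube_rpow_le (c : Eucl n) {r : ℝ} (hr : 0 < r)
    {K : NNReal} {f : Eucl n → ℝ} (hf : LipschitzOnWith K f (closedCube c r)) {p s t : ℝ}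
    (hp : Real.HolderConjugate n p) (hs : p ≤ s) (ht : 1 / t = 1 / s + 1 / n) :
    ∃ m : ℝ, (∫⁻ x in closedCube c r, ‖f x - m‖ₑ ^ s) ^ (1 / s)
      ≤ (n + 1) * ENNReal.ofReal (s / p)
        * (∫⁻ x in closedCube c r, ‖fderiv ℝ f x‖ₑ ^ t) ^ (1 / t) := by
  have hQm := (isClosed_closedCube c r).measurableSet
  have hfin : IsFiniteMeasure (volume.restrict (closedCube c r)) :=
    ⟨by simpa using (isCompact_closedCube c r).measure_lt_top⟩
  have hp1 : 1 < p := hp.symm.lt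
  have hs0 : 0 < s := by linarith
  have hn0 : (0 : ℝ) < n := hp.pos
  have ht0 : 0 < t := by
    rw [← one_div_pos, ht]
    positivity
  set γ := s / p with hγdef
  have hγ : 1 ≤ γ := by rwa [hγdef, one_le_div (by linarith)]
  have hγp : γ * p = s := div_mul_cancel₀ _ (by linarith)
  obtain ⟨R, hR⟩ := (isCompact_closedCube c r).exists_bound_of_continuousOn hf.continuousOn
  have hR0 : 0 ≤ R := (norm_nonneg _).trans (hR c (mem_closedCube_self c hr.le))
  have hfm : AEStronglyMeasurable f (volume.restrict (closedCube c r)) :=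
    hf.continuousOn.aestronglyMeasurable hQm
  obtain ⟨m, hm, hm0⟩ := exists_integral_signedPow_eq_zero
    (volume.restrict (closedCube c r)) hfm (ae_restrict_of_forall_mem hQm hR) hR0 hγ
  refine ⟨m, ?_⟩
  have hsub : LipschitzOnWith K (fun x => f x - m) (closedCube c r) := by
    intro x hx y hy
    simpa only [edist_sub_right] using hf hx hy
  have hmaps : MapsTo (fun x => f x - m) (closedCube c r) (Icc (-(2 * R)) (2 * R)) := by
    intro x hx
    have := abs_le.1 (hR x hx)
    exact ⟨by linarith [hm.2], by linarith [hm.1]⟩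
  have hg := (lipschitzOnWith_mul_abs_rpow (R := 2 * R) hγ).comp hsub hmaps
  have hA := lintegral_cube_rpow_le_of_lipschitzOnWith c hr hg hm0 hp
  have hgp : ∀ x, ‖((fun y : ℝ => y * |y| ^ (γ - 1)) ∘ fun x => f x - m) x‖ₑ ^ p
      = ‖f x - m‖ₑ ^ s := by
    intro x
    have h : ‖((fun y : ℝ => y * |y| ^ (γ - 1)) ∘ fun x => f x - m) x‖ₑ = ‖f x - m‖ₑ ^ γ := by
      rw [Function.comp_apply, Real.enorm_eq_ofReal_abs, abs_mul_abs_rpow hγ,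
        Real.enorm_eq_ofReal_abs, ENNReal.ofReal_rpow_of_nonneg (abs_nonneg _) (by linarith)]
    rw [h, ← ENNReal.rpow_mul, hγp]
  have hgd : ∀ᵐ x ∂(volume.restrict (closedCube c r)),
      ‖fderiv ℝ ((fun y : ℝ => y * |y| ^ (γ - 1)) ∘ fun x => f x - m) x‖ₑ
        = ENNReal.ofReal γ * (‖f x - m‖ₑ ^ (γ - 1) * ‖fderiv ℝ f x‖ₑ) := by
    filter_upwards [ae_closedCube_mem_nhds c r, hf.ae_differentiableWithinAt hQm] with x hx hd
    have h1 := (hd.differentiableAt hx).hasFDerivAt.sub_const m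
    have h2 := (hasDerivAt_mul_abs_rpow hγ (f x - m)).comp_hasFDerivAt x h1
    rw [h2.fderiv, enorm_smul, enorm_mul, mul_assoc, Real.enorm_of_nonneg (by linarith),
      Real.enorm_of_nonneg (by positivity), Real.enorm_eq_ofReal_abs,
      ENNReal.ofReal_rpow_of_nonneg (abs_nonneg _) (by linarith)]
  rw [lintegral_congr hgp, lintegral_congr_ae hgd,
    lintegral_const_mul' _ _ ENNReal.ofReal_ne_top] at hA
  set X := ∫⁻ x in closedCube c r, ‖f x - m‖ₑ ^ s with hX
  set Y := ∫⁻ x in closedCube c r, ‖fderiv ℝ f x‖ₑ ^ t with hY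
  have hps : 1 / p = γ / s := by
    rw [hγdef]
    field_simp
  have hnp : 1 / (n : ℝ) + 1 / p = 1 := by simpa using hp.inv_add_inv_eq_one
  have hH : ∫⁻ x in closedCube c r, ‖f x - m‖ₑ ^ (γ - 1) * ‖fderiv ℝ f x‖ₑ
      ≤ X ^ ((γ - 1) / s) * Y ^ (1 / t) := by
    refine le_of_eq_of_le ?_ (ENNReal.lintegral_mul_norm_pow_le
      (f := fun x => ‖f x - m‖ₑ ^ s) (g := fun x => ‖fderiv ℝ f x‖ₑ ^ t)
      ((hfm.sub aestronglyMeasurable_const).enorm.pow_const s)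
      ((measurable_enorm_fderiv f).pow_const t).aemeasurable
      (div_nonneg (by linarith) hs0.le) (by positivity) ?_)
    · refine lintegral_congr fun x => ?_
      rw [← ENNReal.rpow_mul, ← ENNReal.rpow_mul, mul_div_cancel₀ _ hs0.ne',
        mul_one_div_cancel ht0.ne', ENNReal.rpow_one]
    · rw [ht, sub_div, ← hps]
      linarith
  have hXtop : X ≠ ⊤ := by
    refine (lt_of_le_of_lt (setLIntegral_mono' hQm
      (g := fun _ => ENNReal.ofReal (2 * R) ^ s) fun x hx => ?_) ?_).ne
    · gcongr
      rw [Real.enorm_eq_ofReal_abs]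
      exact ENNReal.ofReal_le_ofReal (abs_le.2 (hmaps hx))
    · rw [setLIntegral_const]
      exact ENNReal.mul_lt_top (ENNReal.rpow_lt_top_of_nonneg hs0.le ENNReal.ofReal_ne_top)
        (isCompact_closedCube c r).measure_lt_top
  rcases eq_or_ne X 0 with hX0 | hX0
  · rw [hX0, ENNReal.zero_rpow_of_pos (by positivity)]
    exact zero_le
  have hB : X ^ (1 / p) ≤ (n + 1) * (ENNReal.ofReal γ * (X ^ ((γ - 1) / s) * Y ^ (1 / t))) := by
    rw [one_div, ENNReal.rpow_inv_le_iff (by linarith)]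
    refine hA.trans ?_
    gcongr
  have hsplit : X ^ (1 / p) = X ^ ((γ - 1) / s) * X ^ (1 / s) := by
    rw [← ENNReal.rpow_add _ _ hX0 hXtop, hps]
    congr 1
    ring
  rw [hsplit, show (n + 1 : ENNReal) * (ENNReal.ofReal γ * (X ^ ((γ - 1) / s) * Y ^ (1 / t)))
    = X ^ ((γ - 1) / s) * ((n + 1) * ENNReal.ofReal γ * Y ^ (1 / t)) by ring] at hB
  exact (ENNReal.mul_le_mul_iff_right (by simp [hX0, hXtop])
    (ENNReal.rpow_ne_top_of_nonneg (div_nonneg (by linarith) hs0.le) hXtop)).1 hB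

/-- Averaging is a contraction in `L^p`. -/
theorem eLpNorm_average_le {α E : Type*} [MeasurableSpace α] {μ : Measure α} [IsFiniteMeasure μ]
    [NormedAddCommGroup E] [NormedSpace ℝ E] {f : α → E} (hf : AEStronglyMeasurable f μ)
    {p : ENNReal} (hp : 1 ≤ p) :
    eLpNorm (fun _ => ⨍ x, f x ∂μ) p μ ≤ eLpNorm f p μ := by
  rcases eq_or_ne μ 0 with rfl | hμ
  · simp
  have hV0 : μ univ ≠ 0 := by simpa using hμ
  have hVt : μ univ ≠ ⊤ := measure_ne_top μ univ
  rw [eLpNorm_const _ (by positivity) hμ]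
  have h1 : ‖⨍ x, f x ∂μ‖ₑ ≤ (μ univ)⁻¹ * (eLpNorm f p μ * μ univ ^ (1 - 1 / p.toReal)) := by
    rw [average_eq, enorm_smul, measureReal_def, Real.enorm_of_nonneg (by positivity),
      ENNReal.ofReal_inv_of_pos (ENNReal.toReal_pos hV0 hVt), ENNReal.ofReal_toReal hVt]
    gcongr
    refine (enorm_integral_le_lintegral_enorm f).trans ?_
    have := eLpNorm_le_eLpNorm_mul_rpow_measure_univ hp hf
    rwa [eLpNorm_one_eq_lintegral_enorm, ENNReal.toReal_one, div_one] at this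
  calc _ ≤ (μ univ)⁻¹ * (eLpNorm f p μ * μ univ ^ (1 - 1 / p.toReal))
        * μ univ ^ (1 / p.toReal) := by gcongr
    _ = eLpNorm f p μ * ((μ univ)⁻¹ *
        (μ univ ^ (1 - 1 / p.toReal) * μ univ ^ (1 / p.toReal))) := by ring
    _ = eLpNorm f p μ := by
      rw [← ENNReal.rpow_add _ _ hV0 hVt, sub_add_cancel, ENNReal.rpow_one,
        ENNReal.inv_mul_cancel hV0 hVt, mul_one]

/-- The Sobolev–Poincaré inequality on a cube for constant exponents. -/
theorem eLpNorm_sub_avgOn_cube_le (hn : 2 ≤ n) (c : Eucl n) {r : ℝ} (hr : 0 < r)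
    {K : NNReal} {f : Eucl n → ℝ} (hf : LipschitzOnWith K f (closedCube c r)) {S P : ℝ}
    (hS : 1 ≤ S) (hP : 1 ≤ P) (hSP : 1 / P - 1 / n ≤ 1 / S) :
    eLpNorm (fun x => f x - avgOn (closedCube c r) f) (ENNReal.ofReal S)
        (volume.restrict (closedCube c r))
      ≤ ENNReal.ofReal (4 * (n + 1) * S) * volume (closedCube c r) ^ (1 / (n : ℝ) + 1 / S - 1 / P)
        * eLpNorm (fderiv ℝ f) (ENNReal.ofReal P) (volume.restrict (closedCube c r)) := by
  have hQm := (isClosed_closedCube c r).measurableSet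
  have hV0 := volume_closedCube_ne_zero c hr
  have hVt := (isCompact_closedCube c r).measure_lt_top (μ := volume).ne
  have hn2 : (2 : ℝ) ≤ n := by exact_mod_cast hn
  have hfin : IsFiniteMeasure (volume.restrict (closedCube c r)) :=
    ⟨by simpa using hVt.lt_top⟩
  set μ := volume.restrict (closedCube c r) with hμ
  set V := volume (closedCube c r) with hV
  have hμV : μ univ = V := by simp [hμ, hV]
  set p : ℝ := Real.conjExponent n with hpdef
  have hp : Real.HolderConjugate n p := .conjExponent (by linarith)
  have hp1 : 1 < p := hp.symm.lt
  have hp2 : p ≤ 2 := by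
    rw [hpdef, Real.conjExponent, div_le_iff₀ (by linarith)]
    linarith
  have hnp : 1 / (n : ℝ) + 1 / p = 1 := by simpa using hp.inv_add_inv_eq_one
  set s : ℝ := max S p with hsdef
  have hs0 : 0 < s := by
    have := le_max_right S p
    linarith
  have hsS : s ≤ 2 * S := max_le (by linarith) (by linarith)
  set t : ℝ := (1 / s + 1 / n)⁻¹ with htdef
  have ht : 1 / t = 1 / s + 1 / n := by simp [htdef]
  have ht0 : 0 < t := by positivity
  have htP : t ≤ P := by
    rw [← one_div_le_one_div (by linarith) ht0, ht]
    rcases max_cases S p with ⟨h, -⟩ | ⟨h, -⟩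
    · rw [hsdef, h]
      linarith
    · rw [hsdef, h]
      have : 1 / P ≤ 1 := by rw [div_le_one (by linarith)]; exact hP
      linarith
  obtain ⟨m, hm⟩ := exists_lintegral_cube_rpow_le c hr hf hp (le_max_right S p) ht
  have hfm : AEStronglyMeasurable f μ := hf.continuousOn.aestronglyMeasurable hQm
  have hgm : AEStronglyMeasurable (fun x => f x - m) μ := hfm.sub aestronglyMeasurable_const
  have hfi : Integrable f μ := hf.continuousOn.integrableOn_compact (isCompact_closedCube c r)
  have hdm : AEStronglyMeasurable (fderiv ℝ f) μ :=
    (measurable_fderiv ℝ f).aestronglyMeasurable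
  have hnorm : ∀ {E : Type} [NormedAddCommGroup E] (u : Eucl n → E) {a : ℝ}, 0 < a →
      eLpNorm u (ENNReal.ofReal a) μ = (∫⁻ x, ‖u x‖ₑ ^ a ∂μ) ^ (1 / a) := by
    intro E _ u a ha
    rw [eLpNorm_eq_lintegral_rpow_enorm_toReal (by simpa using ha) ENNReal.ofReal_ne_top,
      ENNReal.toReal_ofReal ha.le]
  rw [← hnorm (fun x => f x - m) hs0, ← hnorm (fderiv ℝ f) ht0] at hm
  have h1 := eLpNorm_le_eLpNorm_mul_rpow_measure_univ
    (ENNReal.ofReal_le_ofReal (le_max_left S p)) hgm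
  have h2 := eLpNorm_le_eLpNorm_mul_rpow_measure_univ (ENNReal.ofReal_le_ofReal htP) hdm
  rw [ENNReal.toReal_ofReal (by linarith), ENNReal.toReal_ofReal (by linarith), hμV] at h1 h2
  have hg : eLpNorm (fun x => f x - m) (ENNReal.ofReal S) μ
      ≤ ENNReal.ofReal (2 * (n + 1) * S) * V ^ (1 / (n : ℝ) + 1 / S - 1 / P)
        * eLpNorm (fderiv ℝ f) (ENNReal.ofReal P) μ := by
    have hcst : (n + 1 : ENNReal) * ENNReal.ofReal (s / p) ≤ ENNReal.ofReal (2 * (n + 1) * S) := by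
      rw [show (n + 1 : ENNReal) = ENNReal.ofReal (n + 1) by
        rw [ENNReal.ofReal_add (by positivity) zero_le_one]; simp,
        ← ENNReal.ofReal_mul (by positivity)]
      refine ENNReal.ofReal_le_ofReal ?_
      have : s / p ≤ s := div_le_self hs0.le hp1.le
      nlinarith
    calc _ ≤ ((n + 1) * ENNReal.ofReal (s / p)
          * (eLpNorm (fderiv ℝ f) (ENNReal.ofReal P) μ * V ^ (1 / t - 1 / P)))
            * V ^ (1 / S - 1 / s) := h1.trans (by gcongr; exact hm.trans (by gcongr))
      _ = ((n + 1) * ENNReal.ofReal (s / p)) * (V ^ (1 / t - 1 / P) * V ^ (1 / S - 1 / s))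
          * eLpNorm (fderiv ℝ f) (ENNReal.ofReal P) μ := by ring
      _ ≤ _ := by
        rw [← ENNReal.rpow_add _ _ hV0 hVt, ht, show 1 / s + 1 / (n : ℝ) - 1 / P
          + (1 / S - 1 / s) = 1 / (n : ℝ) + 1 / S - 1 / P by ring]
        gcongr
  have hS1 : 1 ≤ ENNReal.ofReal S := by simpa using hS
  have hμ0 : NeZero μ := ⟨by
    rw [hμ, Ne, Measure.restrict_eq_zero]
    exact hV0⟩
  have havg : ⨍ x, (f x - m) ∂μ = avgOn (closedCube c r) f - m := by
    rw [average_eq, integral_sub hfi (integrable_const m), integral_const, smul_sub, smul_smul,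
      inv_mul_cancel₀ (by simp [measureReal_def, hμV, hV0, hVt, ENNReal.toReal_eq_zero_iff]),
      one_smul, measureReal_def, hμV]
    rfl
  have hfun : (fun x => f x - avgOn (closedCube c r) f)
      = (fun x => f x - m) - fun _ => ⨍ x, (f x - m) ∂μ := by
    funext x
    simp [havg]
  rw [hfun]
  refine (eLpNorm_sub_le hgm aestronglyMeasurable_const hS1).trans ?_
  refine (add_le_add_right (eLpNorm_average_le hgm hS1) _).trans ?_
  refine (add_le_add hg hg).trans (le_of_eq ?_)
  rw [← two_mul, show 4 * ((n : ℝ) + 1) * S = 2 * (2 * (n + 1) * S) by ring,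
    ENNReal.ofReal_mul zero_le_two, ENNReal.ofReal_ofNat]
  ring

end SobolevPoincare

section VariableExponent

/-- The modular controls the norm with a smaller constant exponent. -/
theorem eLpNorm_le_of_lintegral_rpow_le_one {α : Type*} [MeasurableSpace α] {μ : Measure α}
    {p u : α → ℝ} {P l : ℝ} (hP : 1 ≤ P) (hp : ∀ᵐ x ∂μ, P ≤ p x) (hl : 0 < l)
    (h : ∫⁻ x, ENNReal.ofReal ((|u x| / l) ^ p x) ∂μ ≤ 1) :
    eLpNorm u (ENNReal.ofReal P) μ ≤ ENNReal.ofReal l * (1 + μ univ) := by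
  have hP0 : 0 < P := by linarith
  have hw : ∀ x, ‖u x‖ₑ ^ P = ENNReal.ofReal l ^ P * ENNReal.ofReal ((|u x| / l) ^ P) := by
    intro x
    rw [← ENNReal.ofReal_rpow_of_nonneg (by positivity) hP0.le, ← ENNReal.mul_rpow_of_nonneg _ _
      hP0.le, ← ENNReal.ofReal_mul hl.le, mul_div_cancel₀ _ hl.ne', Real.enorm_eq_ofReal_abs]
  have hle : ∫⁻ x, ENNReal.ofReal ((|u x| / l) ^ P) ∂μ ≤ 1 + μ univ := by
    calc _ ≤ ∫⁻ x, 1 + ENNReal.ofReal ((|u x| / l) ^ p x) ∂μ := by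
          refine lintegral_mono_ae ?_
          filter_upwards [hp] with x hx
          rw [← ENNReal.ofReal_one, ← ENNReal.ofReal_add zero_le_one (by positivity)]
          refine ENNReal.ofReal_le_ofReal ?_
          have h0 : 0 ≤ |u x| / l := by positivity
          rcases le_total (|u x| / l) 1 with h1 | h1
          · have := Real.rpow_le_one h0 h1 hP0.le
            have := Real.rpow_nonneg h0 (p x)
            linarith
          · have := Real.rpow_le_rpow_of_exponent_le h1 hx
            linarith
      _ ≤ _ := by
          rw [lintegral_add_left measurable_const, lintegral_const, one_mul, add_comm]
          gcongr
  rw [eLpNorm_eq_lintegral_rpow_enorm_toReal (by simpa using hP0) ENNReal.ofReal_ne_top,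
    ENNReal.toReal_ofReal hP0.le, lintegral_congr hw, lintegral_const_mul' _ _
    (ENNReal.rpow_ne_top_of_nonneg hP0.le ENNReal.ofReal_ne_top),
    ENNReal.mul_rpow_of_nonneg _ _ (by positivity), ← ENNReal.rpow_mul,
    mul_one_div_cancel hP0.ne', ENNReal.rpow_one]
  gcongr
  calc _ ≤ (1 + μ univ) ^ (1 / P) := by gcongr
    _ ≤ (1 + μ univ) ^ (1 : ℝ) := by
      refine ENNReal.rpow_le_rpow_of_exponent_le le_self_add ?_
      rw [div_le_one hP0]
      exact hP
    _ = _ := ENNReal.rpow_one _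

/-- The norm with a larger constant exponent controls the modular. -/
theorem lintegral_rpow_le_one_of_eLpNorm_le {α : Type*} [MeasurableSpace α] {μ : Measure α}
    [IsFiniteMeasure μ] {q g : α → ℝ} {S l : ℝ} (hS : 0 < S)
    (hq : ∀ᵐ x ∂μ, 1 ≤ q x ∧ q x ≤ S) (hl : 0 < l)
    (h : eLpNorm g (ENNReal.ofReal S) μ ≤ ENNReal.ofReal l) :
    ∫⁻ x, ENNReal.ofReal ((|g x| / (l * (1 + (μ univ).toReal))) ^ q x) ∂μ ≤ 1 := by
  set V := (μ univ).toReal with hV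
  have hV0 : 0 ≤ V := ENNReal.toReal_nonneg
  have hVe : μ univ = ENNReal.ofReal V := (ENNReal.ofReal_toReal (measure_ne_top _ _)).symm
  have hw : ∀ x, ENNReal.ofReal ((|g x| / l) ^ S) = (ENNReal.ofReal l ^ S)⁻¹ * ‖g x‖ₑ ^ S := by
    intro x
    rw [← ENNReal.ofReal_rpow_of_nonneg (by positivity) hS.le, ENNReal.ofReal_div_of_pos hl,
      ENNReal.div_rpow_of_nonneg _ _ hS.le, Real.enorm_eq_ofReal_abs, div_eq_mul_inv, mul_comm]
  have hlS : ENNReal.ofReal l ^ S ≠ 0 := by simp [hl, ENNReal.rpow_eq_zero_iff]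
  have hlt : ENNReal.ofReal l ^ S ≠ ⊤ :=
    ENNReal.rpow_ne_top_of_nonneg hS.le ENNReal.ofReal_ne_top
  have hint : ∫⁻ x, ENNReal.ofReal ((|g x| / l) ^ S) ∂μ ≤ 1 := by
    rw [lintegral_congr hw, lintegral_const_mul' _ _ (ENNReal.inv_ne_top.2 hlS)]
    rw [eLpNorm_eq_lintegral_rpow_enorm_toReal (by simpa using hS) ENNReal.ofReal_ne_top,
      ENNReal.toReal_ofReal hS.le, one_div, ENNReal.rpow_inv_le_iff hS] at h
    calc _ ≤ (ENNReal.ofReal l ^ S)⁻¹ * ENNReal.ofReal l ^ S := by gcongr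
      _ = 1 := ENNReal.inv_mul_cancel hlS hlt
  calc _ ≤ ∫⁻ x, ENNReal.ofReal (1 + V)⁻¹ * (1 + ENNReal.ofReal ((|g x| / l) ^ S)) ∂μ := by
        refine lintegral_mono_ae ?_
        filter_upwards [hq] with x hx
        have h0 : 0 ≤ |g x| / l := by positivity
        rw [← ENNReal.ofReal_one, ← ENNReal.ofReal_add zero_le_one (by positivity),
          ← ENNReal.ofReal_mul (by positivity)]
        refine ENNReal.ofReal_le_ofReal ?_
        rw [show |g x| / (l * (1 + V)) = (1 + V)⁻¹ * (|g x| / l) by field_simp,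
          Real.mul_rpow (by positivity) h0]
        gcongr
        · refine (Real.rpow_le_rpow_of_exponent_ge (by positivity)
            (inv_le_one_of_one_le₀ (by linarith)) hx.1).trans_eq (Real.rpow_one _)
        · rcases le_total (|g x| / l) 1 with h1 | h1
          · have := Real.rpow_le_one h0 h1 (by linarith [hx.1] : 0 ≤ q x)
            have := Real.rpow_nonneg h0 S
            linarith
          · have := Real.rpow_le_rpow_of_exponent_le h1 hx.2
            linarith
    _ ≤ ENNReal.ofReal (1 + V)⁻¹ * (ENNReal.ofReal V + 1) := by
        rw [lintegral_const_mul' _ _ ENNReal.ofReal_ne_top, lintegral_add_left measurable_const,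
          lintegral_const, one_mul, hVe]
        gcongr
    _ = 1 := by
        rw [← ENNReal.ofReal_one, ← ENNReal.ofReal_add hV0 zero_le_one,
          ← ENNReal.ofReal_mul (by positivity), add_comm V 1, inv_mul_cancel₀ (by positivity)]

variable {n : ℕ}

theorem LocLipschitzOn.exists_lipschitzOnWith {A : Set (Eucl n)} {f : Eucl n → ℝ}
    (hf : LocLipschitzOn A f) (hA : IsCompact A) : ∃ K : NNReal, LipschitzOnWith K f A := by
  refine LocallyLipschitzOn.exists_lipschitzOnWith_of_compact hA fun x hx => ?_
  obtain ⟨K, t, ht, hK⟩ := hf x hx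
  exact ⟨K, t ∩ A, inter_mem (mem_nhdsWithin_of_mem_nhds ht) self_mem_nhdsWithin, hK⟩

theorem memVarLp_gradNorm_of_lipschitzOnWith (c : Eucl n) (r : ℝ) {K : NNReal} {f : Eucl n → ℝ}
    (hf : LipschitzOnWith K f (closedCube c r)) {p : Eucl n → ℝ}
    (hp : ∀ x ∈ closedCube c r, 1 ≤ p x) : MemVarLp (closedCube c r) p (gradNorm f) := by
  have hVt := (isCompact_closedCube c r).measure_lt_top (μ := volume).ne
  set V := (volume (closedCube c r)).toReal with hV
  have hV0 : 0 ≤ V := ENNReal.toReal_nonneg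
  have hK0 : (0 : ℝ) ≤ K := K.2
  refine ⟨(K + 1) * (1 + V), by positivity, ?_⟩
  calc _ ≤ ∫⁻ x in closedCube c r, ENNReal.ofReal (1 + V)⁻¹ := by
        refine lintegral_mono_ae ?_
        filter_upwards [ae_closedCube_mem_nhds c r] with x hx
        refine ENNReal.ofReal_le_ofReal ?_
        have hd : gradNorm f x ≤ K := norm_fderiv_le_of_lipschitzOn ℝ hx hf
        have hg0 : 0 ≤ gradNorm f x := norm_nonneg _
        have hb : |gradNorm f x| / ((K + 1) * (1 + V)) ≤ (1 + V)⁻¹ := by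
          rw [abs_of_nonneg hg0, div_le_iff₀ (by positivity),
            mul_left_comm, inv_mul_cancel₀ (by positivity)]
          linarith
        refine le_trans ?_ hb
        refine (Real.rpow_le_rpow_of_exponent_ge' (by positivity)
          (hb.trans (inv_le_one_of_one_le₀ (by linarith))) zero_le_one
          (hp x (mem_of_mem_nhds hx))).trans_eq (Real.rpow_one _)
    _ = ENNReal.ofReal ((1 + V)⁻¹ * V) := by
        rw [setLIntegral_const, ENNReal.ofReal_mul (by positivity), hV, ENNReal.ofReal_toReal hVt]
    _ ≤ 1 := by
        rw [ENNReal.ofReal_le_one, inv_mul_le_iff₀ (by positivity)]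
        linarith

/-- The variable exponent Sobolev–Poincaré inequality on a cube, in terms of any constant
exponents `P ≤ p` and `S ≥ q` related by Sobolev's condition. -/
theorem luxNorm_sub_avgOn_cube_le (hn : 2 ≤ n) (c : Eucl n) {r : ℝ} (hr : 0 < r)
    {p q f : Eucl n → ℝ} (hp1 : ∀ x ∈ closedCube c r, 1 ≤ p x)
    (hf : LocLipschitzOn (closedCube c r) f) {S P : ℝ} (hS : 1 ≤ S) (hP : 1 ≤ P)
    (hSP : 1 / P - 1 / n ≤ 1 / S)
    (hp : ∀ᵐ x ∂(volume.restrict (closedCube c r)), P ≤ p x)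
    (hq : ∀ᵐ x ∂(volume.restrict (closedCube c r)), 1 ≤ q x ∧ q x ≤ S) :
    luxNorm (closedCube c r) q (fun x => f x - avgOn (closedCube c r) f)
      ≤ 4 * (n + 1) * S * (1 + (volume (closedCube c r)).toReal) ^ 2
        * (volume (closedCube c r)).toReal ^ (1 / (n : ℝ) + 1 / S - 1 / P)
        * luxNorm (closedCube c r) p (gradNorm f) := by
  obtain ⟨K, hK⟩ := hf.exists_lipschitzOnWith (isCompact_closedCube c r)
  have hVt := (isCompact_closedCube c r).measure_lt_top (μ := volume).ne
  have hfin : IsFiniteMeasure (volume.restrict (closedCube c r)) :=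
    ⟨by simpa using hVt.lt_top⟩
  set V := (volume (closedCube c r)).toReal with hV
  have hV0 : 0 < V := ENNReal.toReal_pos (volume_closedCube_ne_zero c hr) hVt
  have hVe : volume (closedCube c r) = ENNReal.ofReal V := (ENNReal.ofReal_toReal hVt).symm
  set e := 1 / (n : ℝ) + 1 / S - 1 / P with he
  have hc0 : 0 < 4 * (n + 1) * S * (1 + V) ^ 2 * V ^ e := by positivity
  rw [← div_le_iff₀' hc0]
  refine le_csInf (memVarLp_gradNorm_of_lipschitzOnWith c r hK hp1) ?_
  rintro l ⟨hl, hint⟩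
  rw [div_le_iff₀' hc0]
  have h1 := eLpNorm_le_of_lintegral_rpow_le_one hP hp hl hint
  rw [show gradNorm f = fun x => ‖fderiv ℝ f x‖ from rfl, eLpNorm_norm,
    Measure.restrict_apply_univ, hVe, ← ENNReal.ofReal_one,
    ← ENNReal.ofReal_add zero_le_one hV0.le, ← ENNReal.ofReal_mul hl.le] at h1
  have h2 := eLpNorm_sub_avgOn_cube_le hn c hr hK hS hP hSP
  rw [hVe, ENNReal.ofReal_rpow_of_pos hV0, ← ENNReal.ofReal_mul (by positivity)] at h2
  have h3 : eLpNorm (fun x => f x - avgOn (closedCube c r) f) (ENNReal.ofReal S)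
      (volume.restrict (closedCube c r))
        ≤ ENNReal.ofReal (4 * (n + 1) * S * V ^ e * (l * (1 + V))) := by
    refine h2.trans ?_
    rw [ENNReal.ofReal_mul (p := 4 * (n + 1) * S * V ^ e) (by positivity)]
    gcongr
  have h4 := lintegral_rpow_le_one_of_eLpNorm_le (by linarith) hq (by positivity) h3
  rw [Measure.restrict_apply_univ, ← hV] at h4
  rw [show 4 * (n + 1) * S * (1 + V) ^ 2 * V ^ e * l
    = 4 * (n + 1) * S * V ^ e * (l * (1 + V)) * (1 + V) by ring]
  exact csInf_le ⟨0, fun x hx => hx.1.le⟩ ⟨by positivity, h4⟩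

end VariableExponent

/-- Lemma 6.4, variable exponent Sobolev–Poincaré inequality on cubes. -/
theorem sobolev_poincare_cube_variable_exponent
    (n : ℕ) (hn : 2 ≤ n) :
    ∃ C : ℝ → ℝ, ∃ C' : ℝ, 0 < C' ∧
      ∀ (c : Eucl n) (r : ℝ), 0 < r →
      ∀ p : Eucl n → ℝ, Measurable p → (∀ x ∈ closedCube c r, 1 ≤ p x) →
        (∃ M : ℝ, ∀ᵐ x ∂(volume.restrict (closedCube c r)), p x ≤ M) →
      ∀ α : ℝ, 0 ≤ α →
      ∀ q : Eucl n → ℝ, (∀ x ∈ closedCube c r, 1 / q x = 1 / p x - α / n) →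
        (∀ x ∈ closedCube c r, 1 ≤ q x) →
        (∃ M : ℝ, ∀ᵐ x ∂(volume.restrict (closedCube c r)), q x ≤ M) →
      -- case (i) or case (ii)
      ((essInfOn p (closedCube c r) < n ∧
          essInfOn p (closedCube c r) ≤ essSupOn q (closedCube c r) ∧
          essSupOn q (closedCube c r)
            ≤ n * essInfOn p (closedCube c r) / (n - essInfOn p (closedCube c r))) ∨
        (n : ℝ) ≤ essInfOn p (closedCube c r)) →
      ∀ f : Eucl n → ℝ, LocLipschitzOn (closedCube c r) f →
        IntegrableOn f (closedCube c r) volume →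
        (luxNorm (closedCube c r) q (fun x => f x - avgOn (closedCube c r) f)
            ≤ C (essSupOn q (closedCube c r))
              * (1 + (volume (closedCube c r)).toReal) ^ 2
              * (volume (closedCube c r)).toReal
                  ^ (1 / (n:ℝ) + 1 / essSupOn q (closedCube c r)
                      - 1 / essInfOn p (closedCube c r))
              * luxNorm (closedCube c r) p (gradNorm f)) ∧
        (essInfOn p (closedCube c r) < n →
          luxNorm (closedCube c r) q (fun x => f x - avgOn (closedCube c r) f)
            ≤ C' * essSupOn q (closedCube c r)
              * (1 + (volume (closedCube c r)).toReal) ^ 2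
              * (volume (closedCube c r)).toReal
                  ^ (1 / (n:ℝ) + 1 / essSupOn q (closedCube c r)
                      - 1 / essInfOn p (closedCube c r))
              * luxNorm (closedCube c r) p (gradNorm f)) := by
  refine ⟨fun S => 4 * (n + 1) * S, 4 * (n + 1), by positivity, ?_⟩
  intro c r hr p _ hp1 hpM α _ q _ hq1 hqM hcase f hf _
  suffices h : luxNorm (closedCube c r) q (fun x => f x - avgOn (closedCube c r) f) ≤ _ from
    ⟨h, fun _ => h⟩
  have hQm := (isClosed_closedCube c r).measurableSet
  have hne : NeBot (ae (volume.restrict (closedCube c r))) := by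
    rw [ae_neBot, Ne, Measure.restrict_eq_zero]
    exact volume_closedCube_ne_zero c hr
  obtain ⟨M, hM⟩ := hpM
  obtain ⟨N, hN⟩ := hqM
  have hp1' : ∀ᵐ x ∂(volume.restrict (closedCube c r)), 1 ≤ p x :=
    ae_restrict_of_forall_mem hQm hp1
  have hP : ∀ᵐ x ∂(volume.restrict (closedCube c r)), essInfOn p (closedCube c r) ≤ p x :=
    ae_essInf_le ⟨1, hp1'⟩
  have hq : ∀ᵐ x ∂(volume.restrict (closedCube c r)),
      1 ≤ q x ∧ q x ≤ essSupOn q (closedCube c r) :=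
    (ae_restrict_of_forall_mem hQm hq1).and (ae_le_essSup ⟨N, hN⟩)
  have hP1 : 1 ≤ essInfOn p (closedCube c r) :=
    le_liminf_of_le (IsBoundedUnder.isCoboundedUnder_ge ⟨M, hM⟩) hp1'
  obtain ⟨x, hx1, hx2⟩ := hq.exists
  have hS1 := hx1.trans hx2
  refine luxNorm_sub_avgOn_cube_le hn c hr hp1 hf hS1 hP1 ?_ hP hq
  have hn0 : (0 : ℝ) < n := by positivity
  rcases hcase with ⟨h1, -, h3⟩ | h
  · rw [le_div_iff₀ (by linarith)] at h3
    rw [div_sub_div _ _ (by linarith) hn0.ne', div_le_div_iff₀ (by positivity) (by linarith)]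
    linarith
  · have h1 := one_div_le_one_div_of_le hn0 h
    have h2 : 0 ≤ 1 / essSupOn q (closedCube c r) := by positivity
    linarith
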